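/- arXiv:1908.11413 — 7 statements merged into one kernel-verified Lean document; each statement's English description precedes it below -/
import Mathlib

section
/- For every positive integer m, Σ_{i=1}^{m} ( Σ_{j=1}^{m} |i−j| )² = (m/60)(7m⁴ − 15m² + 8). -/
theorem sum_Icc_abs_sub_of_le {n i : ℕ} (h : n ≤ i) :
    ∑ j ∈ Finset.Icc 1 n, |(i : ℝ) - (j : ℝ)| = n * i - n * (n + 1) / 2 := by
  induction n with
  | zero => simp
  | succ k ih =>
    have hk : ((k + 1 : ℕ) : ℝ) ≤ i := by exact_mod_cast h
    rw [Finset.sum_Icc_succ_top (by omega), ih (by omega), abs_of_nonneg (by linarith)]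
    push_cast
    ring

theorem sum_Icc_abs_sub {i m : ℕ} (h : i ≤ m) :
    ∑ j ∈ Finset.Icc 1 m, |(i : ℝ) - (j : ℝ)|
      = (i : ℝ) ^ 2 - (m + 1) * i + m * (m + 1) / 2 := by
  induction m, h using Nat.le_induction with
  | base =>
    rw [sum_Icc_abs_sub_of_le le_rfl]
    ring
  | succ k hik ih =>
    have hk : (i : ℝ) ≤ k := by exact_mod_cast hik
    rw [Finset.sum_Icc_succ_top (by omega), ih, abs_of_nonpos (by push_cast; linarith)]
    push_cast
    ring

theorem sum_Icc_sq_quadratic (x : ℝ) (n : ℕ) :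
    ∑ i ∈ Finset.Icc 1 n, ((i : ℝ) ^ 2 - (x + 1) * i + x * (x + 1) / 2) ^ 2
      = n * (n + 1) * (2 * n + 1) * (3 * n ^ 2 + 3 * n - 1) / 30
        - 2 * (x + 1) * (n * (n + 1) / 2) ^ 2
        + ((x + 1) ^ 2 + x * (x + 1)) * (n * (n + 1) * (2 * n + 1) / 6)
        - x * (x + 1) ^ 2 * (n * (n + 1) / 2)
        + n * (x * (x + 1) / 2) ^ 2 := by
  induction n with
  | zero => simp
  | succ k ih =>
    rw [Finset.sum_Icc_succ_top (by omega), ih]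
    push_cast
    ring

theorem stmt5 (m : ℕ) (hm : 1 ≤ m) :
    ∑ i ∈ Finset.Icc 1 m, (∑ j ∈ Finset.Icc 1 m, |(i : ℝ) - (j : ℝ)|) ^ 2
      = (m : ℝ) / 60 * (7 * (m : ℝ) ^ 4 - 15 * (m : ℝ) ^ 2 + 8) := by
  rw [Finset.sum_congr rfl fun i hi => by rw [sum_Icc_abs_sub (Finset.mem_Icc.mp hi).2],
    sum_Icc_sq_quadratic]
  ring
end

section
/- Let b_s ≥ 2, L ≥ ℓ ≥ 0, and let u ∈ ℝ^{b_s^L} be a vector satisfying |u(i) − u(j)| ≤ K|i−j| for all indices i, j and some constant K ≥ 0. Then ‖u − ext_ℓ(ave_ℓ(u))‖² ≤ b_s^L K² (7 b_s^{2ℓ} − 15 + 8 b_s^{−2ℓ})/60, where ‖·‖ is the Euclidean norm on ℝ^{b_s^L}. -/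
/-- One-dimensional block-extension of a vector (0-indexed). -/
noncomputable def vext (b ℓ : ℕ) (u : ℕ → ℝ) : ℕ → ℝ :=
  fun i => u (i / b ^ ℓ)

/-- One-dimensional block-average of a vector (0-indexed). -/
noncomputable def vave (b ℓ : ℕ) (u : ℕ → ℝ) : ℕ → ℝ :=
  fun i => ((b : ℝ) ^ ℓ)⁻¹ * ∑ j : Fin (b ^ ℓ), u (i * b ^ ℓ + (j : ℕ))

theorem sum_range_sum_range_sub_sq (n : ℕ) (v : ℕ → ℝ) :
    ∑ i ∈ Finset.range n, ∑ j ∈ Finset.range n, (v i - v j) ^ 2 =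
      2 * (n * ∑ i ∈ Finset.range n, v i ^ 2 - (∑ i ∈ Finset.range n, v i) ^ 2) := by
  simp only [sub_sq, Finset.sum_add_distrib, Finset.sum_sub_distrib, ← Finset.mul_sum,
    ← Finset.sum_mul, Finset.sum_const, Finset.card_range, nsmul_eq_mul]
  ring

theorem mul_sum_range_sub_mean_sq {n : ℕ} (hn : n ≠ 0) (v : ℕ → ℝ) :
    n * ∑ i ∈ Finset.range n, (v i - (n : ℝ)⁻¹ * ∑ j ∈ Finset.range n, v j) ^ 2 =
      n * ∑ i ∈ Finset.range n, v i ^ 2 - (∑ i ∈ Finset.range n, v i) ^ 2 := by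
  have hn' : (n : ℝ) ≠ 0 := Nat.cast_ne_zero.mpr hn
  simp only [sub_sq, Finset.sum_add_distrib, Finset.sum_sub_distrib, ← Finset.mul_sum,
    ← Finset.sum_mul, Finset.sum_const, Finset.card_range, nsmul_eq_mul]
  field_simp
  ring

theorem sum_range_cast_real (n : ℕ) :
    ∑ i ∈ Finset.range n, (i : ℝ) = n * (n - 1) / 2 := by
  induction n with
  | zero => simp
  | succ n ih => rw [Finset.sum_range_succ, ih]; push_cast; ring

theorem sum_range_cast_real_sq (n : ℕ) :
    ∑ i ∈ Finset.range n, (i : ℝ) ^ 2 = n * (n - 1) * (2 * n - 1) / 6 := by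
  induction n with
  | zero => simp
  | succ n ih => rw [Finset.sum_range_succ, ih]; push_cast; ring

/-- The squared deviation from the mean of a `K`-Lipschitz sequence is at most that of the
linear sequence of slope `K`. -/
theorem sum_range_sub_mean_sq_le {n : ℕ} (hn : n ≠ 0) (K : ℝ) (v : ℕ → ℝ)
    (hv : ∀ i j, i < n → j < n → |v i - v j| ≤ K * |(i : ℝ) - (j : ℝ)|) :
    ∑ i ∈ Finset.range n, (v i - (n : ℝ)⁻¹ * ∑ j ∈ Finset.range n, v j) ^ 2 ≤
      n * (K ^ 2 * ((n : ℝ) ^ 2 - 1) / 12) := by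
  have hn' : (0 : ℝ) < n := Nat.cast_pos.mpr (Nat.pos_of_ne_zero hn)
  have hpairs : ∑ i ∈ Finset.range n, ∑ j ∈ Finset.range n, (v i - v j) ^ 2 ≤
      K ^ 2 * ∑ i ∈ Finset.range n, ∑ j ∈ Finset.range n, ((i : ℝ) - (j : ℝ)) ^ 2 := by
    simp only [Finset.mul_sum]
    refine Finset.sum_le_sum fun i hi => Finset.sum_le_sum fun j hj => ?_
    have h := hv i j (Finset.mem_range.mp hi) (Finset.mem_range.mp hj)
    calc (v i - v j) ^ 2 = |v i - v j| ^ 2 := (sq_abs _).symm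
      _ ≤ (K * |(i : ℝ) - (j : ℝ)|) ^ 2 := pow_le_pow_left₀ (abs_nonneg _) h 2
      _ = K ^ 2 * ((i : ℝ) - (j : ℝ)) ^ 2 := by rw [mul_pow, sq_abs]
  rw [sum_range_sum_range_sub_sq n v, sum_range_sum_range_sub_sq n (fun i => (i : ℝ)),
    ← mul_sum_range_sub_mean_sq hn v, sum_range_cast_real, sum_range_cast_real_sq] at hpairs
  refine le_of_mul_le_mul_left ?_ hn'
  linarith

theorem sum_range_mul_le_of_block_le (m n : ℕ) (f : ℕ → ℝ) (C : ℝ)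
    (h : ∀ k < m, ∑ i ∈ Finset.range n, f (k * n + i) ≤ C) :
    ∑ i ∈ Finset.range (m * n), f i ≤ m * C := by
  induction m with
  | zero => simp
  | succ m ih =>
    rw [Nat.succ_mul, Finset.sum_range_add]
    have h₁ := ih fun k hk => h k (hk.trans m.lt_succ_self)
    have h₂ := h m m.lt_succ_self
    push_cast
    linarith

theorem stmt6 (b L ℓ : ℕ) (hb : 2 ≤ b) (hℓL : ℓ ≤ L) (K : ℝ) (hK : 0 ≤ K)
    (u : ℕ → ℝ)
    (hu : ∀ i j, i < b ^ L → j < b ^ L → |u i - u j| ≤ K * |(i : ℝ) - (j : ℝ)|) :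
    ∑ i : Fin (b ^ L), (u (i : ℕ) - vext b ℓ (vave b ℓ u) (i : ℕ)) ^ 2
      ≤ (b : ℝ) ^ L * K ^ 2 *
          (7 * (b : ℝ) ^ (2 * ℓ) - 15 + 8 * ((b : ℝ) ^ (2 * ℓ))⁻¹) / 60 := by
  have hn : b ^ ℓ ≠ 0 := pow_ne_zero _ (by omega)
  have hL : b ^ L = b ^ (L - ℓ) * b ^ ℓ := by rw [← pow_add, Nat.sub_add_cancel hℓL]
  have hLr : (b : ℝ) ^ L = (b : ℝ) ^ (L - ℓ) * (b : ℝ) ^ ℓ := by exact_mod_cast hL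
  have hblock : ∀ k < b ^ (L - ℓ), ∑ i ∈ Finset.range (b ^ ℓ),
      (u (k * b ^ ℓ + i) - vext b ℓ (vave b ℓ u) (k * b ^ ℓ + i)) ^ 2 ≤
        ((b ^ ℓ : ℕ) : ℝ) * (K ^ 2 * (((b ^ ℓ : ℕ) : ℝ) ^ 2 - 1) / 12) := by
    intro k hk
    have hlt : ∀ i < b ^ ℓ, k * b ^ ℓ + i < b ^ L := fun i hi => by
      have := Nat.mul_le_mul_right (b ^ ℓ) (Nat.succ_le_of_lt hk)
      rw [Nat.succ_mul] at this
      omega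
    refine le_of_eq_of_le (Finset.sum_congr rfl fun i hi => ?_)
      (sum_range_sub_mean_sq_le hn K (fun i => u (k * b ^ ℓ + i)) fun i j hi hj => ?_)
    · have hdiv : (k * b ^ ℓ + i) / b ^ ℓ = k := by
        rw [mul_comm, Nat.mul_add_div (Nat.pos_of_ne_zero hn),
          Nat.div_eq_of_lt (Finset.mem_range.mp hi), add_zero]
      simp only [vext, vave, hdiv, Nat.cast_pow]
      rw [Fin.sum_univ_eq_sum_range fun j => u (k * b ^ ℓ + j)]
    · have h := hu _ _ (hlt i hi) (hlt j hj)
      push_cast at h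
      rwa [add_sub_add_left_eq_sub] at h
  rw [Fin.sum_univ_eq_sum_range fun i => (u i - vext b ℓ (vave b ℓ u) i) ^ 2, hL]
  refine (sum_range_mul_le_of_block_le _ _ _ _ hblock).trans ?_
  have hpoly : 5 * ((b : ℝ) ^ (2 * ℓ) - 1) ≤
      7 * (b : ℝ) ^ (2 * ℓ) - 15 + 8 * ((b : ℝ) ^ (2 * ℓ))⁻¹ := by
    rcases Nat.eq_zero_or_pos ℓ with rfl | hpos
    · norm_num
    · have hfour : (4 : ℝ) ≤ (b : ℝ) ^ (2 * ℓ) := by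
        have : 2 ^ 2 ≤ b ^ (2 * ℓ) :=
          (Nat.pow_le_pow_left hb 2).trans (Nat.pow_le_pow_right (by omega) (by omega))
        exact_mod_cast this
      generalize (b : ℝ) ^ (2 * ℓ) = x at hfour ⊢
      have hx : 0 < x := by linarith
      have hdiff : 7 * x - 15 + 8 * x⁻¹ - 5 * (x - 1) = 2 * (x - 1) * (x - 4) / x := by
        field_simp
        ring
      have : 0 ≤ 2 * (x - 1) * (x - 4) / x :=
        div_nonneg (mul_nonneg (by linarith) (by linarith)) hx.le
      linarith
  have hscaled := mul_le_mul_of_nonneg_left hpoly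
    (mul_nonneg (pow_nonneg (Nat.cast_nonneg b) L) (sq_nonneg K) : 0 ≤ (b : ℝ) ^ L * K ^ 2)
  rw [mul_comm 2 ℓ, pow_mul, hLr] at *
  push_cast
  linarith
end

section
/- Let u_1,…,u_d and v_1,…,v_d be nonzero vectors in ℝ^{n_1},…,ℝ^{n_d}. Then the elementary tensors satisfy ‖⊗_{j=1}^d u_j − ⊗_{j=1}^d v_j‖ ≤ ( Π_{j=1}^d (1 + ‖u_j − v_j‖/‖u_j‖) − 1 ) · Π_{j=1}^d ‖u_j‖, where ‖·‖ denotes the Frobenius norm on tensors and the Euclidean norm on vectors. -/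
/-- Euclidean norm of a vector restricted to indices `{0,…,n-1}`. -/
noncomputable def vnorm (n : ℕ) (u : ℕ → ℝ) : ℝ :=
  Real.sqrt (∑ i : Fin n, u (i : ℕ) ^ 2)

/-- Frobenius norm of a tensor over the rectangular grid `∏_j {0,…,n j - 1}`. -/
noncomputable def rnorm (d : ℕ) (n : Fin d → ℕ) (T : (Fin d → ℕ) → ℝ) : ℝ :=
  Real.sqrt (∑ i : (j : Fin d) → Fin (n j), T (fun j => (i j : ℕ)) ^ 2)

theorem rnorm_eq_norm_toLp (d : ℕ) (n : Fin d → ℕ) (T : (Fin d → ℕ) → ℝ) :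
    rnorm d n T =
      ‖WithLp.toLp 2 (fun i : (j : Fin d) → Fin (n j) => T (fun j => (i j : ℕ)))‖ := by
  simp [rnorm, EuclideanSpace.norm_eq]

theorem rnorm_sum_le {ι : Type*} (d : ℕ) (n : Fin d → ℕ) (s : Finset ι)
    (T : ι → (Fin d → ℕ) → ℝ) :
    rnorm d n (fun i => ∑ t ∈ s, T t i) ≤ ∑ t ∈ s, rnorm d n (T t) := by
  simp only [rnorm_eq_norm_toLp]
  refine le_of_eq_of_le (congrArg _ ?_) (norm_sum_le _ _)
  ext i
  simp

theorem rnorm_sub_comm (d : ℕ) (n : Fin d → ℕ) (S T : (Fin d → ℕ) → ℝ) :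
    rnorm d n (fun i => S i - T i) = rnorm d n (fun i => T i - S i) := by
  simp only [rnorm, sub_sq_comm]

theorem vnorm_sub_comm (n : ℕ) (u v : ℕ → ℝ) :
    vnorm n (fun t => u t - v t) = vnorm n (fun t => v t - u t) := by
  simp only [vnorm, sub_sq_comm]

theorem rnorm_prod (d : ℕ) (n : Fin d → ℕ) (w : Fin d → ℕ → ℝ) :
    rnorm d n (fun i => ∏ j, w j (i j)) = ∏ j, vnorm (n j) (w j) := by
  have h : (∑ i : (j : Fin d) → Fin (n j), (∏ j, w j (i j : ℕ)) ^ 2) =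
      ∏ j, ∑ k : Fin (n j), w j (k : ℕ) ^ 2 := by
    simp only [← Finset.prod_pow, Finset.prod_univ_sum, Fintype.piFinset_univ]
  simp only [rnorm, vnorm]
  rw [h, Real.sqrt_prod _ fun j _ => Finset.sum_nonneg fun k _ => sq_nonneg _]

theorem prod_add_sub_prod {ι R : Type*} [Fintype ι] [DecidableEq ι] [CommRing R] (f g : ι → R) :
    ∏ j, (f j + g j) - ∏ j, f j =
      ∑ t ∈ Finset.univ.erase Finset.univ, ∏ j, if j ∈ t then f j else g j := by
  have h : ∏ j, (f j + g j) = ∑ t : Finset ι, ∏ j, if j ∈ t then f j else g j := by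
    rw [Finset.prod_add, Finset.powerset_univ]
    refine Finset.sum_congr rfl fun t _ => ?_
    rw [Finset.prod_ite]
    congr 2 <;> ext j <;> simp
  rw [h, ← Finset.add_sum_erase _ _ (Finset.mem_univ Finset.univ)]
  simp

theorem stmt7 (d : ℕ) (n : Fin d → ℕ) (u v : Fin d → ℕ → ℝ)
    (hu : ∀ j, vnorm (n j) (u j) ≠ 0) (hv : ∀ j, vnorm (n j) (v j) ≠ 0) :
    rnorm d n (fun i => (∏ j : Fin d, u j (i j)) - ∏ j : Fin d, v j (i j))
      ≤ ((∏ j : Fin d, (1 + vnorm (n j) (fun t => u j t - v j t) / vnorm (n j) (u j))) - 1)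
          * ∏ j : Fin d, vnorm (n j) (u j) := by
  have hR : ((∏ j : Fin d, (1 + vnorm (n j) (fun t => u j t - v j t) / vnorm (n j) (u j))) - 1)
      * ∏ j : Fin d, vnorm (n j) (u j) =
      ∏ j, (vnorm (n j) (u j) + vnorm (n j) (fun t => v j t - u j t)) -
        ∏ j, vnorm (n j) (u j) := by
    rw [sub_mul, one_mul, ← Finset.prod_mul_distrib]
    congr 1
    refine Finset.prod_congr rfl fun j _ => ?_
    rw [vnorm_sub_comm (n j) (v j), add_mul, one_mul, div_mul_cancel₀ _ (hu j)]
  have hL (i : Fin d → ℕ) : ∏ j, v j (i j) - ∏ j, u j (i j) =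
      ∑ t ∈ Finset.univ.erase Finset.univ,
        ∏ j, (if j ∈ t then u j else fun k => v j k - u j k) (i j) := by
    simpa [ite_apply] using
      prod_add_sub_prod (fun j => u j (i j)) (fun j => v j (i j) - u j (i j))
  rw [hR, rnorm_sub_comm, prod_add_sub_prod]
  simp only [hL]
  refine (rnorm_sum_le _ _ _ _).trans_eq (Finset.sum_congr rfl fun t _ => ?_)
  rw [rnorm_prod]
  simp only [apply_ite]
end

section
/- For every real number a, the 2×2 matrix [[a−1, a],[a, a+1]] has rank 2. Consequently, the set 𝒮 = { c·J + R : c ∈ ℝ, R a 2×2 real matrix with rank(R) ≤ 1 }, where J is the 2×2 all-ones matrix, is not a closed subset of the 2×2 real matrices: the matrices T⁽ⁿ⁾ = n·J − v⁽ⁿ⁾(v⁽ⁿ⁾)ᵀ with v⁽ⁿ⁾ = (√(n+1), √(n−1))ᵀ belong to 𝒮 and converge, as n → ∞, to diag(−1, 1), which does not belong to 𝒮. -/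
open Filter

/-- The 2×2 all-ones matrix. -/
noncomputable def Jmat : Matrix (Fin 2) (Fin 2) ℝ := fun _ _ => 1

/-- The multiresolution low-rank matrix format with batch size 2, one level and
rank vector (1,1): a multiple of the all-ones matrix plus a matrix of rank ≤ 1. -/
noncomputable def MSset : Set (Matrix (Fin 2) (Fin 2) ℝ) :=
  {M | ∃ (c : ℝ) (R : Matrix (Fin 2) (Fin 2) ℝ), R.rank ≤ 1 ∧ M = c • Jmat + R}

/-- The sequence `T⁽ⁿ⁾ = n·J − v⁽ⁿ⁾(v⁽ⁿ⁾)ᵀ` with `v⁽ⁿ⁾ = (√(n+1), √(n−1))ᵀ`. -/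
noncomputable def Tseq (n : ℕ) : Matrix (Fin 2) (Fin 2) ℝ :=
  (n : ℝ) • Jmat -
    Matrix.vecMulVec ![Real.sqrt ((n : ℝ) + 1), Real.sqrt ((n : ℝ) - 1)]
      ![Real.sqrt ((n : ℝ) + 1), Real.sqrt ((n : ℝ) - 1)]

lemma rank_sub_add_one_eq_two (a : ℝ) :
    (!![a - 1, a; a, a + 1] : Matrix (Fin 2) (Fin 2) ℝ).rank = 2 := by
  have hdet : (!![a - 1, a; a, a + 1] : Matrix (Fin 2) (Fin 2) ℝ).det = -1 := by
    rw [Matrix.det_fin_two_of]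
    ring
  have hunit : IsUnit (!![a - 1, a; a, a + 1] : Matrix (Fin 2) (Fin 2) ℝ) := by
    rw [Matrix.isUnit_iff_isUnit_det, hdet]
    exact isUnit_one.neg
  simpa using Matrix.rank_of_isUnit _ hunit

lemma Tseq_mem_MSset (n : ℕ) : Tseq n ∈ MSset := by
  refine ⟨n, _, ?_, sub_eq_add_neg _ _⟩
  rw [← Matrix.neg_vecMulVec]
  exact Matrix.rank_vecMulVec_le _ _

lemma tendsto_sub_sqrt_mul_sqrt :
    Tendsto (fun n : ℕ => (n : ℝ) - √((n : ℝ) + 1) * √((n : ℝ) - 1)) atTop (nhds 0) := by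
  refine tendsto_of_tendsto_of_tendsto_of_le_of_le' tendsto_const_nhds
    tendsto_one_div_atTop_nhds_zero_nat ?_ ?_
  all_goals
    filter_upwards [eventually_ge_atTop 1] with n hn
    have hn' : (1 : ℝ) ≤ n := by exact_mod_cast hn
    have hsq : (√((n : ℝ) + 1) * √((n : ℝ) - 1)) ^ 2 = (n : ℝ) ^ 2 - 1 := by
      rw [mul_pow, Real.sq_sqrt (by linarith), Real.sq_sqrt (by linarith)]
      ring
    have hnonneg : 0 ≤ √((n : ℝ) + 1) * √((n : ℝ) - 1) := by positivity
    have hle : √((n : ℝ) + 1) * √((n : ℝ) - 1) ≤ n :=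
      (sq_le_sq₀ hnonneg (by linarith)).1 (by linarith)
  · linarith
  · rw [le_div_iff₀ (by linarith)]
    nlinarith

lemma tendsto_Tseq :
    Tendsto Tseq atTop (nhds (!![-1, 0; 0, 1] : Matrix (Fin 2) (Fin 2) ℝ)) := by
  refine tendsto_pi_nhds.2 fun i => tendsto_pi_nhds.2 fun j => ?_
  fin_cases i <;> fin_cases j
  · refine tendsto_const_nhds.congr fun n => ?_
    have h : √((n : ℝ) + 1) * √((n : ℝ) + 1) = n + 1 := Real.mul_self_sqrt (by positivity)
    simp [Tseq, Jmat, h]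
  · simpa [Tseq, Jmat] using tendsto_sub_sqrt_mul_sqrt
  · simpa [Tseq, Jmat, mul_comm] using tendsto_sub_sqrt_mul_sqrt
  · refine tendsto_const_nhds.congr' ?_
    filter_upwards [eventually_ge_atTop 1] with n hn
    have hn' : (1 : ℝ) ≤ n := by exact_mod_cast hn
    have h : √((n : ℝ) - 1) * √((n : ℝ) - 1) = n - 1 := Real.mul_self_sqrt (by linarith)
    simp [Tseq, Jmat, h]

lemma diag_notMem_MSset : (!![-1, 0; 0, 1] : Matrix (Fin 2) (Fin 2) ℝ) ∉ MSset := by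
  rintro ⟨c, R, hR, h⟩
  have hRc : R = !![-c - 1, -c; -c, -c + 1] := by
    rw [← sub_eq_iff_eq_add'.2 h]
    ext i j
    fin_cases i <;> fin_cases j <;> simp [Jmat] <;> ring
  rw [hRc, rank_sub_add_one_eq_two] at hR
  omega

theorem stmt9 :
    (∀ a : ℝ, (!![a - 1, a; a, a + 1] : Matrix (Fin 2) (Fin 2) ℝ).rank = 2) ∧
    (∀ n : ℕ, Tseq n ∈ MSset) ∧
    Tendsto Tseq atTop (nhds (!![-1, 0; 0, 1] : Matrix (Fin 2) (Fin 2) ℝ)) ∧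
    (!![-1, 0; 0, 1] : Matrix (Fin 2) (Fin 2) ℝ) ∉ MSset ∧
    ¬ IsClosed MSset := by
  exact ⟨rank_sub_add_one_eq_two, Tseq_mem_MSset, tendsto_Tseq, diag_notMem_MSset, fun hclosed =>
    diag_notMem_MSset
      (hclosed.mem_of_tendsto tendsto_Tseq (Eventually.of_forall Tseq_mem_MSset))⟩
end

section
/- For every integer m ≥ 2 and every real number a, the m×m matrix M defined by M(1,1) = a−1; M(1,j) = M(i,1) = a for all i, j ≥ 2; M(i,j) = a+1 for all 2 ≤ i, j ≤ m with i ≠ j; M(2,2) = a+1; and M(i,i) = a for all 3 ≤ i ≤ m, is invertible. -/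
theorem stmt12 (m : ℕ) (hm : 2 ≤ m) (a : ℝ) :
    IsUnit (Matrix.of (fun i j : Fin m =>
      if (i : ℕ) = 0 ∧ (j : ℕ) = 0 then a - 1
      else if (i : ℕ) = 0 ∨ (j : ℕ) = 0 then a
      else if i ≠ j then a + 1
      else if (i : ℕ) = 1 then a + 1
      else a)) := by
  obtain ⟨n, rfl⟩ := Nat.exists_eq_add_of_le' hm
  rw [← Matrix.mulVec_injective_iff_isUnit, ← Matrix.coe_mulVecLin,
    injective_iff_map_eq_zero]
  intro v hv
  rw [Matrix.mulVecLin_apply] at hv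
  have h₀ : (a - 1) * v 0 + (a * v 1 + a * ∑ k : Fin n, v k.succ.succ) = 0 := by
    simpa [Matrix.mulVec, dotProduct, Fin.sum_univ_succ, Finset.mul_sum] using congrFun hv 0
  have h₁ : a * v 0 + ((a + 1) * v 1 + (a + 1) * ∑ k : Fin n, v k.succ.succ) = 0 := by
    simpa [Matrix.mulVec, dotProduct, Fin.sum_univ_succ, Finset.mul_sum]
      using congrFun hv 1
  have h₂ (i : Fin n) : v i.succ.succ = 0 := by
    have hsum : ∑ k : Fin n, (if i = k then a else a + 1) * v k.succ.succ
        = (a + 1) * (∑ k : Fin n, v k.succ.succ) - v i.succ.succ := by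
      have hterm (k : Fin n) : (if i = k then a else a + 1) * v k.succ.succ
          = (a + 1) * v k.succ.succ - if i = k then v k.succ.succ else 0 := by
        split_ifs <;> ring
      simp [hterm, Finset.sum_sub_distrib, Finset.mul_sum]
    have hi : a * v 0 + ((a + 1) * v 1 +
        ∑ k : Fin n, (if i = k then a else a + 1) * v k.succ.succ) = 0 := by
      simpa [Matrix.mulVec, dotProduct, Fin.sum_univ_succ]
        using congrFun hv i.succ.succ
    linarith
  simp only [h₂, Finset.sum_const_zero, mul_zero, add_zero] at h₀ h₁
  have hv₀ : v 0 = 0 := by linear_combination a * h₁ - (a + 1) * h₀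
  have hv₁ : v 1 = 0 := by linear_combination (1 - a) * h₁ + a * h₀
  ext i
  refine Fin.cases hv₀ (fun j => ?_) i
  exact Fin.cases hv₁ h₂ j
end

section
/- Fix b_s ≥ 2, L ≥ 0, d ≥ 1, and for each 0 ≤ k ≤ L let F_k be a closed subset of the space of tensors indexed by {1,…,b_s^k}^d. Let MS = { Σ_{k=0}^{L} ext_{L−k}(T_k) : T_k ∈ F_k }. Suppose T⁽ⁿ⁾ = Σ_{k=0}^{L} ext_{L−k}(T_k⁽ⁿ⁾) with T_k⁽ⁿ⁾ ∈ F_k is a sequence in MS converging (in Frobenius norm) to a tensor T, and suppose the sequence is stable, i.e., there is a constant C < ∞ with ‖T_k⁽ⁿ⁾‖ ≤ C ‖T⁽ⁿ⁾‖ for all k and n. Then T ∈ MS. -/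
open Filter

/-- Frobenius norm of a tensor indexed by a finite type. -/
noncomputable def fnorm {ι : Type*} [Fintype ι] (T : ι → ℝ) : ℝ :=
  Real.sqrt (∑ i, T i ^ 2)

/-- Block-extension of a tensor on the grid `{0,…,bs^k - 1}^d` to the grid
`{0,…,bs^L - 1}^d` (0-indexed). -/
def extG (bs d k L : ℕ) (h : k ≤ L) (T : (Fin d → Fin (bs ^ k)) → ℝ) :
    (Fin d → Fin (bs ^ L)) → ℝ :=
  fun i => T fun j =>
    ⟨(i j : ℕ) / bs ^ (L - k), by
      apply Nat.div_lt_of_lt_mul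
      calc ((i j : ℕ)) < bs ^ L := (i j).isLt
        _ = bs ^ (L - k + k) := by rw [Nat.sub_add_cancel h]
        _ = bs ^ (L - k) * bs ^ k := pow_add bs (L - k) k⟩

theorem abs_apply_le_fnorm {ι : Type*} [Fintype ι] (T : ι → ℝ) (i : ι) : |T i| ≤ fnorm T :=
  Real.abs_le_sqrt <|
    Finset.single_le_sum (f := fun i => T i ^ 2) (fun j _ => sq_nonneg (T j)) (Finset.mem_univ i)

theorem fnorm_nonneg {ι : Type*} [Fintype ι] (T : ι → ℝ) : 0 ≤ fnorm T :=
  Real.sqrt_nonneg _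

theorem norm_le_fnorm {ι : Type*} [Fintype ι] (T : ι → ℝ) : ‖T‖ ≤ fnorm T :=
  (pi_norm_le_iff_of_nonneg (fnorm_nonneg T)).2 (abs_apply_le_fnorm T)

theorem continuous_fnorm {ι : Type*} [Fintype ι] : Continuous (fnorm : (ι → ℝ) → ℝ) := by
  unfold fnorm
  fun_prop

theorem continuous_extG (bs d k L : ℕ) (h : k ≤ L) : Continuous (extG bs d k L h) := by
  unfold extG
  fun_prop

/-- Convergence in Frobenius norm implies convergence in the product topology. -/
theorem tendsto_of_fnorm_sub_tendsto_zero {ι α : Type*} [Fintype ι] {l : Filter α}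
    {S : α → ι → ℝ} {T : ι → ℝ} (h : Tendsto (fun n => fnorm fun i => S n i - T i) l (nhds 0)) :
    Tendsto S l (nhds T) := by
  rw [tendsto_iff_norm_sub_tendsto_zero]
  exact squeeze_zero (fun _ => norm_nonneg _) (fun n => norm_le_fnorm (S n - T)) h

theorem stmt13 (bs d L : ℕ) (hbs : 2 ≤ bs) (hd : 1 ≤ d)
    (F : (k : Fin (L + 1)) → Set ((Fin d → Fin (bs ^ (k : ℕ))) → ℝ))
    (hF : ∀ k, IsClosed (F k))
    (Tk : ℕ → (k : Fin (L + 1)) → ((Fin d → Fin (bs ^ (k : ℕ))) → ℝ))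
    (hmem : ∀ n k, Tk n k ∈ F k)
    (T : (Fin d → Fin (bs ^ L)) → ℝ)
    (hconv : Tendsto (fun n => fnorm (fun i =>
        (∑ k : Fin (L + 1), extG bs d (k : ℕ) L (Nat.lt_succ_iff.mp k.isLt) (Tk n k)) i
          - T i)) atTop (nhds 0))
    (C : ℝ)
    (hstable : ∀ n (k : Fin (L + 1)), fnorm (Tk n k)
        ≤ C * fnorm (∑ k' : Fin (L + 1),
            extG bs d (k' : ℕ) L (Nat.lt_succ_iff.mp k'.isLt) (Tk n k'))) :
    ∃ Tlim : (k : Fin (L + 1)) → ((Fin d → Fin (bs ^ (k : ℕ))) → ℝ),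
      (∀ k, Tlim k ∈ F k) ∧
      T = ∑ k : Fin (L + 1), extG bs d (k : ℕ) L (Nat.lt_succ_iff.mp k.isLt) (Tlim k) := by
  have hS := tendsto_of_fnorm_sub_tendsto_zero hconv
  obtain ⟨B, hB⟩ := (((continuous_fnorm.tendsto T).comp hS).const_mul C).bddAbove_range
  have hbound : ∀ n k, fnorm (Tk n k) ≤ B := fun n k =>
    (hstable n k).trans (hB (Set.mem_range_self n))
  have hB0 : 0 ≤ B := (fnorm_nonneg _).trans (hbound 0 0)
  have hball : ∀ n, Tk n ∈ Metric.closedBall 0 B := fun n => by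
    rw [mem_closedBall_zero_iff, pi_norm_le_iff_of_nonneg hB0]
    exact fun k => (norm_le_fnorm _).trans (hbound n k)
  obtain ⟨Tlim, -, φ, hφ, hlim⟩ := tendsto_subseq_of_bounded Metric.isBounded_closedBall hball
  have hlim' := tendsto_pi_nhds.1 hlim
  refine ⟨Tlim, fun k => (hF k).mem_of_tendsto (hlim' k) (.of_forall fun n => hmem (φ n) k), ?_⟩
  refine tendsto_nhds_unique (hS.comp hφ.tendsto_atTop) ?_
  exact tendsto_finsetSum _ fun k _ => ((continuous_extG bs d k L _).tendsto _).comp (hlim' k)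
end

section
/- Let T = Σ_{k=0}^{L} ext_{L−k}(T_k) and S = Σ_{k=0}^{L} ext_{L−k}(S_k) be tensors indexed by {1,…,b_s^L}^d, with T_k, S_k indexed by {1,…,b_s^k}^d. Define, for each 0 ≤ k ≤ L, R_k = T_k ∘ ( Σ_{ℓ=0}^{k} ext_{k−ℓ}(S_ℓ) ) + S_k ∘ ( Σ_{ℓ=0}^{k−1} ext_{k−ℓ}(T_ℓ) ), where ∘ denotes the entrywise (Hadamard) product. Then T ∘ S = Σ_{k=0}^{L} ext_{L−k}(R_k). In particular, ext_ℓ(A) ∘ ext_ℓ(B) = ext_ℓ(A ∘ B) for tensors A, B on a common grid. -/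
/-- Block-extension of a `d`-dimensional tensor (0-indexed). -/
noncomputable def ext (bs ℓ d : ℕ) (T : (Fin d → ℕ) → ℝ) : (Fin d → ℕ) → ℝ :=
  fun i => T fun j => i j / bs ^ ℓ

theorem sum_range_mul_sum_range_eq_sum_partial {R : Type*} [CommSemiring R] (a b : ℕ → R)
    (n : ℕ) :
    (∑ k ∈ Finset.range n, a k) * (∑ k ∈ Finset.range n, b k)
      = ∑ k ∈ Finset.range n,
          (a k * (∑ l ∈ Finset.range (k + 1), b l) + b k * (∑ l ∈ Finset.range k, a l)) := by
  induction n with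
  | zero => simp
  | succ n ih =>
    simp only [Finset.sum_range_succ] at ih ⊢
    rw [← ih]
    ring

theorem ext_ext (bs ℓ m d : ℕ) (T : (Fin d → ℕ) → ℝ) :
    ext bs ℓ d (ext bs m d T) = ext bs (ℓ + m) d T := by
  funext i
  simp only [ext, Nat.div_div_eq_div_mul, pow_add]

theorem ext_sub_apply {bs d k l L : ℕ} (hlk : l ≤ k) (hkL : k ≤ L)
    (T : (Fin d → ℕ) → ℝ) (i : Fin d → ℕ) :
    ext bs (k - l) d T (fun j => i j / bs ^ (L - k)) = ext bs (L - l) d T i := by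
  rw [← Nat.sub_add_sub_cancel hkL hlk, ← ext_ext]
  rfl

theorem stmt14 (bs d L : ℕ) (hbs : 2 ≤ bs) (hd : 1 ≤ d)
    (T_ S_ : ℕ → ((Fin d → ℕ) → ℝ))
    (T S : (Fin d → ℕ) → ℝ)
    (hT : T = fun i => ∑ k ∈ Finset.range (L + 1), ext bs (L - k) d (T_ k) i)
    (hS : S = fun i => ∑ k ∈ Finset.range (L + 1), ext bs (L - k) d (S_ k) i)
    (R : ℕ → ((Fin d → ℕ) → ℝ))
    (hR : ∀ k, R k = fun i =>
        T_ k i * (∑ ℓ ∈ Finset.range (k + 1), ext bs (k - ℓ) d (S_ ℓ) i)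
          + S_ k i * (∑ ℓ ∈ Finset.range k, ext bs (k - ℓ) d (T_ ℓ) i)) :
    (fun i => T i * S i)
      = (fun i => ∑ k ∈ Finset.range (L + 1), ext bs (L - k) d (R k) i) ∧
    ∀ (ℓ : ℕ) (A B : (Fin d → ℕ) → ℝ),
      (fun i => ext bs ℓ d A i * ext bs ℓ d B i) = ext bs ℓ d (fun i => A i * B i) := by
  refine ⟨?_, fun _ _ _ => rfl⟩
  funext i
  subst hT hS
  dsimp only
  rw [sum_range_mul_sum_range_eq_sum_partial]
  refine Finset.sum_congr rfl fun k hk => ?_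
  have hkL : k ≤ L := Nat.lt_succ_iff.mp (Finset.mem_range.mp hk)
  rw [hR k]
  simp only [ext.eq_1 bs (L - k) d]
  congr 2 <;> refine Finset.sum_congr rfl fun l hl => ?_
  · exact (ext_sub_apply (Nat.lt_succ_iff.mp (Finset.mem_range.mp hl)) hkL _ i).symm
  · exact (ext_sub_apply (Finset.mem_range.mp hl).le hkL _ i).symm
end
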